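/- arXiv:math/0508403 — 7 statements merged into one kernel-verified Lean document; each statement's English description precedes it below -/
import Mathlib

section
/- Let p be a prime with p ≡ 3 (mod 4), let i, j ∈ F_p be nonzero and let k ∈ F_p. Set V = i·j − (k − i − j)²/4 ∈ F_p. Then: (i) if V is not a square in F_p, then N_{ij}^k = 0; (ii) if V = 0, then N_{ij}^k = p + 1; (iii) if V is a nonzero square in F_p, then N_{ij}^k = 2(p + 1). -/
open Finset

/-- The circle of quadrance `K` centered at the origin in `F_p × F_p`. -/
def circ (p : ℕ) [NeZero p] (K : ZMod p) : Finset (ZMod p × ZMod p) :=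
  Finset.univ.filter (fun v => v.1 ^ 2 + v.2 ^ 2 = K)

/-- `N_{ij}^k`: the number of pairs `(a, b)` with `a ∈ C_i`, `b ∈ C_j`, `a + b ∈ C_k`. -/
def Ncirc (p : ℕ) [NeZero p] (i j k : ZMod p) : ℕ :=
  ((circ p i ×ˢ circ p j).filter (fun ab => ab.1 + ab.2 ∈ circ p k)).card

/-- The random-walk kernel of the unit circle: `A(i,j) = N_{i1}^j / (|C_i|·|C_1|)`. -/
noncomputable def kerA (p : ℕ) [NeZero p] : Matrix (ZMod p) (ZMod p) ℝ :=
  fun i j => (Ncirc p i 1 j : ℝ) / (((circ p i).card : ℝ) * ((circ p 1).card : ℝ))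

/-- The stationary distribution: `π(0) = 1/p²`, `π(j) = (p+1)/p²` for `j ≠ 0`. -/
noncomputable def piDist (p : ℕ) [NeZero p] (j : ZMod p) : ℝ :=
  if j = 0 then 1 / (p : ℝ) ^ 2 else ((p : ℝ) + 1) / (p : ℝ) ^ 2

theorem circ_card_le (p : ℕ) [Fact p.Prime] (i j : ZMod p) (hi : i ≠ 0) (hj : j ≠ 0) :
    (circ p i).card ≤ (circ p j).card := by
  obtain ⟨u, v, huv⟩ := ZMod.sq_add_sq p (j / i)
  have huv' : (u ^ 2 + v ^ 2) * i = j := by rw [huv]; field_simp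
  have hn : u ^ 2 + v ^ 2 ≠ 0 := by
    intro h; rw [h] at huv'; apply hj; rw [← huv']; ring
  apply Finset.card_le_card_of_injOn
    (fun w : ZMod p × ZMod p => (u * w.1 - v * w.2, u * w.2 + v * w.1))
  · rintro ⟨x, y⟩ h
    simp only [circ, Finset.coe_filter, Finset.mem_univ, true_and, Set.mem_setOf_eq] at h ⊢
    rw [← huv', ← h]; ring
  · rintro ⟨x, y⟩ - ⟨z, w⟩ - h
    simp only [Prod.mk.injEq] at h ⊢
    obtain ⟨h1, h2⟩ := h
    constructor
    · apply mul_left_cancel₀ hn; linear_combination u * h1 + v * h2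
    · apply mul_left_cancel₀ hn; linear_combination u * h2 - v * h1

theorem circ_card_zero (p : ℕ) [Fact p.Prime] (hp : p % 4 = 3) : (circ p 0).card = 1 := by
  rw [Finset.card_eq_one]
  refine ⟨(0, 0), ?_⟩
  ext ⟨x, y⟩
  simp only [circ, Finset.mem_filter, Finset.mem_univ, true_and, Finset.mem_singleton,
    Prod.mk.injEq]
  constructor
  · intro h
    have hy : y = 0 := by
      by_contra hy
      have : IsSquare (-1 : ZMod p) := by
        refine ⟨x / y, ?_⟩
        field_simp
        linear_combination -h
      rw [ZMod.exists_sq_eq_neg_one_iff] at this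
      exact this hp
    subst hy
    refine ⟨?_, rfl⟩
    simpa using h
  · rintro ⟨rfl, rfl⟩; ring

theorem circ_card (p : ℕ) [Fact p.Prime] (hp : p % 4 = 3) (i : ZMod p) (hi : i ≠ 0) :
    (circ p i).card = p + 1 := by
  have h1 : ∑ K : ZMod p, (circ p K).card = p * p := by
    have := Finset.card_eq_sum_card_fiberwise (s := (Finset.univ : Finset (ZMod p × ZMod p)))
      (t := (Finset.univ : Finset (ZMod p))) (f := fun v => v.1 ^ 2 + v.2 ^ 2)
      (by intro x _; simp)
    simp only [Finset.card_univ, Fintype.card_prod, ZMod.card] at this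
    rw [this]; rfl
  rw [← Finset.add_sum_erase _ _ (Finset.mem_univ (0 : ZMod p)), circ_card_zero p hp,
    Finset.sum_congr rfl (g := fun _ => (circ p i).card)
      (fun K hK => le_antisymm (circ_card_le p K i (Finset.ne_of_mem_erase hK) hi)
        (circ_card_le p i K hi (Finset.ne_of_mem_erase hK)))] at h1
  rw [Finset.sum_const, Finset.card_erase_of_mem (Finset.mem_univ _), Finset.card_univ,
    ZMod.card, smul_eq_mul] at h1
  obtain ⟨q, rfl⟩ : ∃ q, p = q + 1 := ⟨p - 1, by omega⟩
  have hq : 0 < q := by omega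
  simp only [Nat.add_sub_cancel] at h1
  apply Nat.eq_of_mul_eq_mul_left hq
  nlinarith

theorem Ncirc_eq (p : ℕ) [Fact p.Prime] (hp : p % 4 = 3)
    (i j k : ZMod p) (hi : i ≠ 0)
    (V : ZMod p) (hV : V = i * j - (k - i - j) ^ 2 / 4) :
    Ncirc p i j k = (p + 1) * (Finset.univ.filter (fun m : ZMod p => m ^ 2 = V)).card := by
  have h2 : (2 : ZMod p) ≠ 0 := by
    intro h
    have : ((2 : ℕ) : ZMod p) = 0 := by exact_mod_cast h
    rw [ZMod.natCast_eq_zero_iff] at this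
    have := Nat.le_of_dvd (by norm_num) this
    omega
  obtain ⟨d, hd⟩ : ∃ d, d = (k - i - j) / 2 := ⟨_, rfl⟩
  have hk : k = 2 * d + i + j := by rw [hd]; field_simp; ring
  have hV' : V = i * j - d ^ 2 := by
    rw [hV, hd, div_pow]; norm_num
  clear hV hd
  rw [← circ_card p hp i hi, ← Finset.card_product]
  unfold Ncirc
  refine Finset.card_bij'
    (fun ab _ => (ab.1, ab.1.1 * ab.2.2 - ab.1.2 * ab.2.1))
    (fun ae _ => (ae.1, ((d * ae.1.1 - ae.2 * ae.1.2) / i, (d * ae.1.2 + ae.2 * ae.1.1) / i)))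
    ?_ ?_ ?_ ?_
  · rintro ⟨⟨x, y⟩, ⟨z, w⟩⟩ h
    simp only [circ, Finset.mem_filter, Finset.mem_product, Finset.mem_univ, true_and,
      Prod.mk_add_mk] at h ⊢
    obtain ⟨⟨ha, hb⟩, hc⟩ := h
    refine ⟨ha, ?_⟩
    have hdd : x * z + y * w = d := by
      apply mul_left_cancel₀ h2; linear_combination hc + hk - ha - hb
    rw [hV', ← hdd, ← ha, ← hb]; ring
  · rintro ⟨⟨x, y⟩, e⟩ h
    simp only [circ, Finset.mem_filter, Finset.mem_product, Finset.mem_univ, true_and,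
      Prod.mk_add_mk] at h ⊢
    obtain ⟨ha, he⟩ := h
    have hb : ((d * x - e * y) / i) ^ 2 + ((d * y + e * x) / i) ^ 2 = j := by
      field_simp
      linear_combination (d ^ 2 + e ^ 2) * ha + i * he + i * hV'
    have hdd : x * ((d * x - e * y) / i) + y * ((d * y + e * x) / i) = d := by
      field_simp
      linear_combination d * ha
    refine ⟨⟨ha, hb⟩, ?_⟩
    linear_combination ha + hb + 2 * hdd - hk
  · rintro ⟨⟨x, y⟩, ⟨z, w⟩⟩ h
    simp only [circ, Finset.mem_filter, Finset.mem_product, Finset.mem_univ, true_and,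
      Prod.mk_add_mk] at h ⊢
    obtain ⟨⟨ha, hb⟩, hc⟩ := h
    have hdd : x * z + y * w = d := by
      apply mul_left_cancel₀ h2; linear_combination hc + hk - ha - hb
    simp only [Prod.mk.injEq, true_and]
    constructor
    · rw [div_eq_iff hi, ← hdd, ← ha]; ring
    · rw [div_eq_iff hi, ← hdd, ← ha]; ring
  · rintro ⟨⟨x, y⟩, e⟩ h
    simp only [circ, Finset.mem_filter, Finset.mem_product, Finset.mem_univ, true_and] at h ⊢
    obtain ⟨ha, he⟩ := h
    simp only [Prod.mk.injEq, true_and]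
    field_simp
    linear_combination e * ha

/-- the values of `N_{ij}^k` according to whether
`V = i·j − (k − i − j)²/4` is a non-square, zero, or a nonzero square. -/
theorem Ncirc_values (p : ℕ) [Fact p.Prime] (hp : p % 4 = 3)
    (i j k : ZMod p) (hi : i ≠ 0) (hj : j ≠ 0)
    (V : ZMod p) (hV : V = i * j - (k - i - j) ^ 2 / 4) :
    (¬ (∃ m : ZMod p, m ^ 2 = V) → Ncirc p i j k = 0) ∧
    (V = 0 → Ncirc p i j k = p + 1) ∧
    (V ≠ 0 → (∃ m : ZMod p, m ^ 2 = V) → Ncirc p i j k = 2 * (p + 1)) := by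
  rw [Ncirc_eq p hp i j k hi V hV]
  refine ⟨?_, ?_, ?_⟩
  · intro h
    push Not at h
    rw [Finset.filter_false_of_mem (fun m _ => h m)]; simp
  · rintro rfl
    have : (Finset.univ.filter (fun m : ZMod p => m ^ 2 = 0)) = {0} := by
      ext m; simp
    rw [this]; simp
  · rintro h0 ⟨m, rfl⟩
    have hm : m ≠ 0 := by rintro rfl; simp at h0
    have : (Finset.univ.filter (fun x : ZMod p => x ^ 2 = m ^ 2)) = {m, -m} := by
      ext x; simp [sq_eq_sq_iff_eq_or_eq_neg]
    have h2 : (2 : ZMod p) ≠ 0 := by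
      intro h
      have : ((2 : ℕ) : ZMod p) = 0 := by exact_mod_cast h
      rw [ZMod.natCast_eq_zero_iff] at this
      have := Nat.le_of_dvd (by norm_num) this
      omega
    rw [this, Finset.card_pair, mul_comm]
    intro h
    apply mul_ne_zero h2 hm
    linear_combination h
end

section
/- Let p be a prime with p ≡ 3 (mod 4). For all nonzero i, j, k, l ∈ F_p there exist points a ∈ C_i, b ∈ C_j, c ∈ C_k such that a + b + c ∈ C_l. -/
open Finset

lemma aux_ne {p : ℕ} [Fact p.Prime] (hp : p % 4 = 3) (x y : ZMod p)
    (h : x ^ 2 + y ^ 2 = 0) : x = 0 ∧ y = 0 := by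
  have key : ∀ x y : ZMod p, x ^ 2 + y ^ 2 = 0 → y = 0 := by
    intro x y h
    by_contra hy
    have : IsSquare (-1 : ZMod p) := ⟨x / y, by field_simp; linear_combination -h⟩
    rw [ZMod.exists_sq_eq_neg_one_iff] at this
    exact this hp
  exact ⟨key y x (by linear_combination h), key x y h⟩

lemma aux_ex {p : ℕ} [Fact p.Prime] (n : ZMod p) : ∃ x y : ZMod p, x ^ 2 + y ^ 2 = n :=
  ZMod.sq_add_sq p n

open Classical in
lemma aux_card {p : ℕ} [Fact p.Prime] (hp : p % 4 = 3) (n : ZMod p) (hn : n ≠ 0) :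
    p + 1 ≤ 2 * (Finset.univ.filter (fun t : ZMod p => ∃ s, t ^ 2 + s ^ 2 = n)).card := by
  obtain ⟨x, y, hxy⟩ := aux_ex n
  have h2 : (2 : ZMod p) ≠ 0 := by
    intro h
    have : ((2 : ℕ) : ZMod p) = 0 := by exact_mod_cast h
    rw [ZMod.natCast_eq_zero_iff] at this
    have := Nat.le_of_dvd (by norm_num) this
    omega
  have hm : ∀ m : ZMod p, 1 + m ^ 2 ≠ 0 := by
    intro m h
    exact one_ne_zero (aux_ne hp 1 m (by linear_combination h)).1
  let F : ZMod p → ZMod p := fun m => (x * (1 - m ^ 2) - y * (2 * m)) / (1 + m ^ 2)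
  let G : ZMod p → ZMod p := fun m => (y * (1 - m ^ 2) + x * (2 * m)) / (1 + m ^ 2)
  have hFG : ∀ m, F m ^ 2 + G m ^ 2 = n := by
    intro m
    have := hm m
    simp only [F, G]
    field_simp
    rw [← hxy]; ring
  have hinj : ∀ m m', F m = F m' → G m = G m' → m = m' := by
    intro m m' h1 h2'
    have a := hm m
    have b := hm m'
    simp only [F, G] at h1 h2'
    rw [div_eq_div_iff a b] at h1 h2'
    have e1 : n * (2 * (m' ^ 2 - m ^ 2)) = 0 := by
      rw [← hxy]; linear_combination x * h1 + y * h2'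
    have e2 : n * (2 * (m * (1 + m' ^ 2) - m' * (1 + m ^ 2))) = 0 := by
      rw [← hxy]; linear_combination x * h2' - y * h1
    have e1' := (mul_eq_zero.mp ((mul_eq_zero.mp e1).resolve_left hn)).resolve_left h2
    have e2' := (mul_eq_zero.mp ((mul_eq_zero.mp e2).resolve_left hn)).resolve_left h2
    have e3 : (m - m') * (1 + m ^ 2) = 0 := by linear_combination e2' - m * e1'
    exact sub_eq_zero.mp ((mul_eq_zero.mp e3).resolve_right a)
  have := Finset.card_le_mul_card_image_of_maps_to
    (s := (Finset.univ : Finset (ZMod p)))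
    (t := Finset.univ.filter (fun t : ZMod p => ∃ s, t ^ 2 + s ^ 2 = n)) (f := F)
    (fun m _ => by simpa using ⟨G m, hFG m⟩) 2 (by
      intro t ht
      obtain ⟨s, hs⟩ := (Finset.mem_filter.mp ht).2
      have hc : ({s, -s} : Finset (ZMod p)).card ≤ 2 := Finset.card_le_two
      refine le_trans (Finset.card_le_card_of_injOn G ?_ ?_) hc
      · intro m h
        have h : F m = t := by simpa using h
        have := hFG m
        rw [h, ← hs] at this
        have := sq_eq_sq_iff_eq_or_eq_neg.mp (add_left_cancel this)
        simpa using this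
      · intro m h m' h' hG
        have h : F m = t := by simpa using h
        have h' : F m' = t := by simpa using h'
        exact hinj m m' (h.trans h'.symm) hG)
  rw [Finset.card_univ, ZMod.card] at this
  omega

lemma aux_pair {p : ℕ} [Fact p.Prime] (i j t s : ZMod p) (hi : i ≠ 0)
    (h : t ^ 2 + s ^ 2 = i * j) : ∃ a1 a2 b1 b2 : ZMod p,
    a1 ^ 2 + a2 ^ 2 = i ∧ b1 ^ 2 + b2 ^ 2 = j ∧
      (a1 + b1) ^ 2 + (a2 + b2) ^ 2 = i + j + 2 * t := by
  obtain ⟨x, y, hxy⟩ := aux_ex i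
  have hb : ((x * t - y * s) / i) ^ 2 + ((y * t + x * s) / i) ^ 2 = j := by
    field_simp
    linear_combination (t ^ 2 + s ^ 2) * hxy + i * h
  refine ⟨x, y, (x * t - y * s) / i, (y * t + x * s) / i, hxy, hb, ?_⟩
  have hd : x * ((x * t - y * s) / i) + y * ((y * t + x * s) / i) = t := by
    field_simp
    linear_combination t * hxy
  linear_combination hxy + hb + 2 * hd

lemma aux_rot {p : ℕ} [Fact p.Prime] (hp : p % 4 = 3) (u1 u2 v1 v2 : ZMod p)
    (h : u1 ^ 2 + u2 ^ 2 = v1 ^ 2 + v2 ^ 2) : ∃ w1 w2 : ZMod p, w1 ^ 2 + w2 ^ 2 = 1 ∧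
      w1 * u1 - w2 * u2 = v1 ∧ w1 * u2 + w2 * u1 = v2 := by
  by_cases h0 : u1 ^ 2 + u2 ^ 2 = 0
  · obtain ⟨rfl, rfl⟩ := aux_ne hp _ _ h0
    obtain ⟨rfl, rfl⟩ := aux_ne hp _ _ (h.symm.trans h0)
    exact ⟨1, 0, by simp⟩
  · refine ⟨(v1 * u1 + v2 * u2) / (u1 ^ 2 + u2 ^ 2), (v2 * u1 - v1 * u2) / (u1 ^ 2 + u2 ^ 2),
      ?_, ?_, ?_⟩
    · field_simp
      linear_combination -(u1 ^ 2 + u2 ^ 2) * h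
    · field_simp
      ring
    · field_simp
      ring

/-- for all nonzero `i, j, k, l` there are points `a ∈ C_i`, `b ∈ C_j`,
`c ∈ C_k` with `a + b + c ∈ C_l`. -/
theorem three_step_reachable (p : ℕ) [Fact p.Prime] (hp : p % 4 = 3)
    (i j k l : ZMod p) (hi : i ≠ 0) (hj : j ≠ 0) (hk : k ≠ 0) (hl : l ≠ 0) :
    ∃ a ∈ circ p i, ∃ b ∈ circ p j, ∃ c ∈ circ p k, a + b + c ∈ circ p l := by
  classical
  have h2 : (2 : ZMod p) ≠ 0 := by
    intro h
    have : ((2 : ℕ) : ZMod p) = 0 := by exact_mod_cast h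
    rw [ZMod.natCast_eq_zero_iff] at this
    have := Nat.le_of_dvd (by norm_num) this
    omega
  have c1 := aux_card hp (i * j) (mul_ne_zero hi hj)
  have c2 := aux_card hp (k * l) (mul_ne_zero hk hl)
  have hinj : ∀ e : ZMod p, Function.Injective (fun t : ZMod p => e + 2 * t) := by
    intro e t t' h
    exact mul_left_cancel₀ h2 (add_left_cancel h)
  rw [← Finset.card_image_of_injective _ (hinj (i + j))] at c1
  rw [← Finset.card_image_of_injective _ (hinj (k + l))] at c2
  obtain ⟨m, hm1, hm2⟩ : ∃ m, m ∈ Finset.image (fun t : ZMod p => i + j + 2 * t)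
      (Finset.univ.filter (fun t : ZMod p => ∃ s, t ^ 2 + s ^ 2 = i * j)) ∧
      m ∈ Finset.image (fun t : ZMod p => k + l + 2 * t)
      (Finset.univ.filter (fun t : ZMod p => ∃ s, t ^ 2 + s ^ 2 = k * l)) := by
    by_contra hcon
    push Not at hcon
    have hd := Finset.card_union_of_disjoint (Finset.disjoint_left.mpr hcon)
    have hle := Finset.card_le_univ (Finset.image (fun t : ZMod p => i + j + 2 * t)
      (Finset.univ.filter (fun t : ZMod p => ∃ s, t ^ 2 + s ^ 2 = i * j)) ∪
      Finset.image (fun t : ZMod p => k + l + 2 * t)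
      (Finset.univ.filter (fun t : ZMod p => ∃ s, t ^ 2 + s ^ 2 = k * l)))
    rw [hd, ZMod.card] at hle
    omega
  simp only [Finset.mem_image, Finset.mem_filter, Finset.mem_univ, true_and] at hm1 hm2
  obtain ⟨t, ⟨s, hts⟩, ht⟩ := hm1
  obtain ⟨t', ⟨s', hts'⟩, ht'⟩ := hm2
  obtain ⟨a1, a2, b1, b2, ha, hb, hab⟩ := aux_pair i j t s hi hts
  obtain ⟨c1, c2, d1, d2, hc, hd, hcd⟩ := aux_pair k l t' s' hk hts'
  obtain ⟨w1, w2, hw, e1, e2⟩ := aux_rot hp (a1 + b1) (a2 + b2) (c1 + d1) (c2 + d2)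
    (by rw [hab, hcd, ht, ht'])
  have f1 : w1 * a1 - w2 * a2 + (w1 * b1 - w2 * b2) + -c1 = d1 := by linear_combination e1
  have f2 : w1 * a2 + w2 * a1 + (w1 * b2 + w2 * b1) + -c2 = d2 := by linear_combination e2
  refine ⟨(w1 * a1 - w2 * a2, w1 * a2 + w2 * a1), ?_,
    (w1 * b1 - w2 * b2, w1 * b2 + w2 * b1), ?_, (-c1, -c2), ?_, ?_⟩
  · simp only [circ, Finset.mem_filter, Finset.mem_univ, true_and]
    linear_combination (a1 ^ 2 + a2 ^ 2) * hw + ha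
  · simp only [circ, Finset.mem_filter, Finset.mem_univ, true_and]
    linear_combination (b1 ^ 2 + b2 ^ 2) * hw + hb
  · simp only [circ, Finset.mem_filter, Finset.mem_univ, true_and]
    linear_combination hc
  · simp only [circ, Finset.mem_filter, Finset.mem_univ, true_and, Prod.mk_add_mk]
    rw [f1, f2, hd]
end

section
/- Let p be a prime with p ≡ 3 (mod 4), let i, j ∈ F_p be nonzero and let k ∈ F_p. Then N_{ij}^k > 0 if and only if V = i·j − (k − i − j)²/4 is a square in F_p. -/
open Finset

/-- for nonzero `i, j`, `N_{ij}^k > 0` iff `V = i·j − (k − i − j)²/4`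
is a square in `F_p`. -/
theorem Ncirc_pos_iff_square (p : ℕ) [Fact p.Prime] (hp : p % 4 = 3)
    (i j k : ZMod p) (hi : i ≠ 0) (hj : j ≠ 0) :
    0 < Ncirc p i j k ↔ ∃ m : ZMod p, m ^ 2 = i * j - (k - i - j) ^ 2 / 4 := by
  have h2 : (2 : ZMod p) ≠ 0 := by
    intro h
    have h' : ((2 : ℕ) : ZMod p) = 0 := by exact_mod_cast h
    rw [ZMod.natCast_eq_zero_iff] at h'
    have := Nat.le_of_dvd (by norm_num) h'
    omega
  have h4 : (4 : ZMod p) ≠ 0 := by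
    have : (4 : ZMod p) = 2 * 2 := by norm_num
    rw [this]
    exact mul_ne_zero h2 h2
  unfold Ncirc
  rw [Finset.card_pos]
  constructor
  · rintro ⟨⟨⟨x, y⟩, ⟨u, v⟩⟩, h⟩
    simp only [circ, Finset.mem_filter, Finset.mem_product, Finset.mem_univ, true_and,
      Prod.mk_add_mk] at h
    obtain ⟨⟨h1, h3⟩, h5⟩ := h
    refine ⟨x * v - y * u, ?_⟩
    have hd : k - i - j = 2 * (x * u + y * v) := by
      rw [← h1, ← h3, ← h5]; ring
    rw [hd, ← h1, ← h3]
    field_simp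
    ring
  · rintro ⟨m, hm⟩
    obtain ⟨x, y, hxy⟩ := ZMod.sq_add_sq p i
    obtain ⟨d, hd⟩ : ∃ d, k - i - j = 2 * d := ⟨(k - i - j) / 2, by field_simp⟩
    have hm' : m ^ 2 + d ^ 2 = i * j := by
      rw [hm, hd]; field_simp; ring
    have hb : ((d * x - m * y) / i) ^ 2 + ((d * y + m * x) / i) ^ 2 = j := by
      field_simp
      linear_combination (m ^ 2 + d ^ 2) * hxy + i * hm'
    have hab : x * ((d * x - m * y) / i) + y * ((d * y + m * x) / i) = d := by
      field_simp
      linear_combination d * hxy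
    refine ⟨((x, y), ((d * x - m * y) / i, (d * y + m * x) / i)), ?_⟩
    simp only [circ, Finset.mem_filter, Finset.mem_product, Finset.mem_univ, true_and,
      Prod.mk_add_mk]
    refine ⟨⟨hxy, hb⟩, ?_⟩
    linear_combination hxy + hb + 2 * hab - hd
end

section
/- Let p be a prime with p ≡ 3 (mod 4) and let i, j ∈ F_p be nonzero. Then the number of k ∈ F_p with N_{ij}^k > 0 is at least (p + 1)/2. -/
open Finset

lemma one_add_sq_ne (p : ℕ) [Fact p.Prime] (hp : p % 4 = 3) (t : ZMod p) : 1 + t ^ 2 ≠ 0 := by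
  intro h
  exact ZMod.mod_four_ne_three_of_sq_eq_neg_one (y := t) (by linear_combination h) hp

lemma two_ne (p : ℕ) [Fact p.Prime] (hp : p % 4 = 3) : (2 : ZMod p) ≠ 0 := by
  intro h
  have h2 : ((2 : ℕ) : ZMod p) = 0 := by exact_mod_cast h
  rw [ZMod.natCast_eq_zero_iff] at h2
  have := Nat.le_of_dvd (by norm_num) h2
  omega

lemma card_circ_ge (p : ℕ) [Fact p.Prime] (hp : p % 4 = 3) (j : ZMod p) (hj : j ≠ 0) :
    p + 1 ≤ (circ p j).card := by
  obtain ⟨x, y, h⟩ := ZMod.sq_add_sq p j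
  have h2 := two_ne p hp
  let u : Option (ZMod p) → ZMod p := fun o => o.elim (-1) (fun t => (1 - t ^ 2) / (1 + t ^ 2))
  let v : Option (ZMod p) → ZMod p := fun o => o.elim 0 (fun t => 2 * t / (1 + t ^ 2))
  have huv : ∀ o, u o ^ 2 + v o ^ 2 = 1 := by
    rintro (_ | t)
    · simp [u, v]
    · have := one_add_sq_ne p hp t
      simp only [u, v, Option.elim]
      field_simp
      ring
  have hinj : ∀ o o', u o = u o' → v o = v o' → o = o' := by
    have key : ∀ t : ZMod p, u (some t) + 1 = 2 / (1 + t ^ 2) := by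
      intro t
      have := one_add_sq_ne p hp t
      simp only [u, Option.elim]
      field_simp
      ring
    have key2 : ∀ t : ZMod p, u (some t) + 1 ≠ 0 := fun t => by
      rw [key]
      exact div_ne_zero h2 (one_add_sq_ne p hp t)
    have key3 : ∀ t : ZMod p, v (some t) = t * (u (some t) + 1) := fun t => by
      rw [key]
      simp only [v, Option.elim]
      ring
    have key4 : u none + 1 = 0 := by simp [u]
    rintro (_ | t) (_ | t') hu hv
    · rfl
    · exact absurd (by rw [← hu]; exact key4) (key2 t')
    · exact absurd (by rw [hu]; exact key4) (key2 t)
    · rw [key3, key3, ← hu] at hv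
      rw [mul_right_cancel₀ (key2 t) hv]
  have hc : Fintype.card (Option (ZMod p)) = p + 1 := by simp [ZMod.card]
  rw [← hc, ← Finset.card_univ]
  apply Finset.card_le_card_of_injOn (fun o => (x * u o - y * v o, x * v o + y * u o))
  · intro o _
    simp only [circ, Finset.coe_filter, Finset.mem_univ, true_and, Set.mem_ofPred_eq]
    linear_combination (x ^ 2 + y ^ 2) * huv o + h
  · intro o _ o' _ ho
    simp only [Prod.mk.injEq] at ho
    obtain ⟨h3, h4⟩ := ho
    apply hinj
    · apply mul_left_cancel₀ hj
      rw [← h]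
      linear_combination x * h3 + y * h4
    · apply mul_left_cancel₀ hj
      rw [← h]
      linear_combination x * h4 - y * h3

/-- for nonzero `i, j`, the number of `k` with `N_{ij}^k > 0`
is at least `(p + 1)/2`. -/
theorem card_reachable_ge (p : ℕ) [Fact p.Prime] (hp : p % 4 = 3)
    (i j : ZMod p) (hi : i ≠ 0) (hj : j ≠ 0) :
    (p + 1) / 2 ≤ (Finset.univ.filter (fun k : ZMod p => 0 < Ncirc p i j k)).card := by
  obtain ⟨a, b, h⟩ := ZMod.sq_add_sq p i
  have h2 := two_ne p hp
  let f : ZMod p × ZMod p → ZMod p := fun v => (a + v.1) ^ 2 + (b + v.2) ^ 2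
  have hsub : (circ p j).image f ⊆ Finset.univ.filter (fun k : ZMod p => 0 < Ncirc p i j k) := by
    intro k hk
    obtain ⟨v, hv, rfl⟩ := Finset.mem_image.1 hk
    refine Finset.mem_filter.2 ⟨Finset.mem_univ _, ?_⟩
    unfold Ncirc
    apply Finset.card_pos.2
    refine ⟨((a, b), v), ?_⟩
    simp only [Finset.mem_filter, Finset.mem_product]
    refine ⟨⟨?_, hv⟩, ?_⟩
    · simp [circ, h]
    · simp [circ, f]
  have hfib : ∀ k ∈ (circ p j).image f, ((circ p j).filter (fun v => f v = k)).card ≤ 2 := by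
    intro k hk
    obtain ⟨w, hw, rfl⟩ := Finset.mem_image.1 hk
    let m := a * w.1 + b * w.2
    let s := a * w.2 - b * w.1
    let g : ZMod p → ZMod p × ZMod p := fun s => ((a * m - b * s) / i, (b * m + a * s) / i)
    refine le_trans (Finset.card_le_card (t := {g s, g (-s)}) ?_) Finset.card_le_two
    intro v hv
    simp only [Finset.mem_filter, circ, Finset.mem_univ, true_and, f] at hv hw
    obtain ⟨hv, hvf⟩ := hv
    have hm : a * v.1 + b * v.2 = m := by
      apply mul_left_cancel₀ h2
      simp only [m]
      linear_combination hvf - hv + hw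
    have hg : v = g (a * v.2 - b * v.1) := by
      ext
      · simp only [g, ← hm]
        rw [eq_div_iff hi, ← h]
        ring
      · simp only [g, ← hm]
        rw [eq_div_iff hi, ← h]
        ring
    have hs : (a * v.2 - b * v.1) ^ 2 = s ^ 2 := by
      simp only [m] at hm
      simp only [s]
      linear_combination (a ^ 2 + b ^ 2) * (hv - hw)
        - (a * v.1 + b * v.2 + a * w.1 + b * w.2) * hm
    rw [Finset.mem_insert, Finset.mem_singleton]
    rcases sq_eq_sq_iff_eq_or_eq_neg.1 hs with e | e
    · left; rw [← e]; exact hg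
    · right; rw [← e]; exact hg
  have h3 := Finset.card_le_mul_card_image (circ p j) 2 hfib
  have h4 := card_circ_ge p hp j hj
  have h5 := Finset.card_le_card hsub
  omega
end

section
/- Let p be a prime with p ≡ 3 (mod 4). The kernel A of the random walk by the unit circle satisfies detailed balance with respect to π: for all i, j ∈ F_p, π(i)·A(i,j) = π(j)·A(j,i). -/
open Finset

theorem circ_card_le_s7 (p : ℕ) [Fact p.Prime] (K L : ZMod p) (hK : K ≠ 0) :
    (circ p L).card ≤ (circ p (K * L)).card := by
  obtain ⟨a, b, hab⟩ := ZMod.sq_add_sq p K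
  apply Finset.card_le_card_of_injOn (fun v => (a * v.1 - b * v.2, a * v.2 + b * v.1))
  · intro v hv
    simp only [circ, Finset.coe_filter, Finset.mem_univ, true_and, Set.mem_setOf_eq] at hv ⊢
    rw [← hab, ← hv]; ring
  · intro v _ w _ h
    simp only [Prod.mk.injEq] at h
    obtain ⟨h1, h2⟩ := h
    ext
    · apply mul_left_cancel₀ hK
      rw [← hab]; linear_combination a * h1 + b * h2
    · apply mul_left_cancel₀ hK
      rw [← hab]; linear_combination a * h2 - b * h1

theorem circ_card_eq (p : ℕ) [Fact p.Prime] (K : ZMod p) (hK : K ≠ 0) :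
    (circ p K).card = (circ p 1).card := by
  apply le_antisymm
  · have := circ_card_le_s7 p K⁻¹ K (inv_ne_zero hK)
    rwa [inv_mul_cancel₀ hK] at this
  · have := circ_card_le_s7 p K 1 hK
    rwa [mul_one] at this

theorem circ_card_one (p : ℕ) [Fact p.Prime] (hp : p % 4 = 3) : (circ p 1).card = p + 1 := by
  have hs : ∑ K : ZMod p, (circ p K).card = p ^ 2 := by
    have := Finset.card_eq_sum_card_fiberwise (s := (Finset.univ : Finset (ZMod p × ZMod p)))
      (t := Finset.univ) (f := fun v => v.1 ^ 2 + v.2 ^ 2) (by intro x _; simp)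
    simp only [Finset.card_univ, Fintype.card_prod, ZMod.card] at this
    rw [sq, this]; rfl
  rw [← Finset.add_sum_erase _ _ (Finset.mem_univ 0), circ_card_zero p hp,
    Finset.sum_congr rfl (fun K hK => circ_card_eq p K (Finset.ne_of_mem_erase hK)),
    Finset.sum_const, Finset.card_erase_of_mem (Finset.mem_univ _), Finset.card_univ,
    ZMod.card] at hs
  have h2 := (Fact.out : p.Prime).two_le
  obtain ⟨q, rfl⟩ : ∃ q, p = q + 1 := ⟨p - 1, by omega⟩
  simp only [Nat.add_sub_cancel, smul_eq_mul] at hs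
  apply Nat.eq_of_mul_eq_mul_left (show 0 < q by omega)
  nlinarith

theorem Ncirc_le (p : ℕ) [Fact p.Prime] (i j : ZMod p) : Ncirc p i 1 j ≤ Ncirc p j 1 i := by
  apply Finset.card_le_card_of_injOn (fun ab => (ab.1 + ab.2, -ab.2))
  · intro v hv
    simp only [circ, Finset.coe_filter, Finset.mem_product, Finset.mem_filter, Finset.mem_univ,
      true_and, Set.mem_setOf_eq] at hv ⊢
    obtain ⟨⟨h1, h2⟩, h3⟩ := hv
    refine ⟨⟨h3, by simpa using h2⟩, by simpa using h1⟩
  · intro v _ w _ h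
    simp only [Prod.mk.injEq, neg_inj] at h
    obtain ⟨h1, h2⟩ := h
    rw [h2] at h1
    exact Prod.ext (add_right_cancel h1) h2

theorem pi_div_card (p : ℕ) [Fact p.Prime] (hp : p % 4 = 3) (i : ZMod p) :
    piDist p i = ((circ p i).card : ℝ) / (p : ℝ) ^ 2 := by
  unfold piDist
  split_ifs with h
  · rw [h, circ_card_zero p hp]; simp
  · rw [circ_card_eq p i h, circ_card_one p hp]; simp

theorem circ_card_ne (p : ℕ) [Fact p.Prime] (hp : p % 4 = 3) (i : ZMod p) :
    ((circ p i).card : ℝ) ≠ 0 := by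
  by_cases h : i = 0
  · rw [h, circ_card_zero p hp]; simp
  · rw [circ_card_eq p i h, circ_card_one p hp]; positivity

/-- the kernel of the random walk by the unit circle satisfies detailed
balance with respect to `π`. -/
theorem kerA_detailed_balance (p : ℕ) [Fact p.Prime] (hp : p % 4 = 3) (i j : ZMod p) :
    piDist p i * kerA p i j = piDist p j * kerA p j i := by
  have hp0 : (p : ℝ) ≠ 0 := by exact_mod_cast (Fact.out : p.Prime).ne_zero
  have hi := circ_card_ne p hp i
  have hj := circ_card_ne p hp j
  have h1 := circ_card_ne p hp 1
  rw [pi_div_card p hp, pi_div_card p hp]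
  unfold kerA
  rw [le_antisymm (Ncirc_le p i j) (Ncirc_le p j i)]
  field_simp
end

section
/- Let p be a prime with p ≡ 3 (mod 4). For every natural number n ≥ 4 and all i, j ∈ F_p, the (i,j) entry of the n-th matrix power Aⁿ of the random-walk kernel A is strictly positive: (Aⁿ)(i,j) > 0. -/
open Finset

lemma aux_aniso {p : ℕ} [Fact p.Prime] (hp : p % 4 = 3) {x y : ZMod p}
    (h : x ^ 2 + y ^ 2 = 0) : x = 0 ∧ y = 0 := by
  have key : ∀ x y : ZMod p, x ^ 2 + y ^ 2 = 0 → x = 0 := by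
    intro x y h
    by_contra hx
    have : IsSquare (-1 : ZMod p) := by
      refine ⟨y / x, ?_⟩
      field_simp
      linear_combination -h
    exact (ZMod.exists_sq_eq_neg_one_iff.1 this) hp
  exact ⟨key x y h, key y x (by rw [add_comm]; exact h)⟩

lemma aux_two {p : ℕ} [Fact p.Prime] (hp : p % 4 = 3) : (2 : ZMod p) ≠ 0 := by
  intro h
  have h1 : (1 : ZMod p) ^ 2 + 1 ^ 2 = 0 := by linear_combination h
  exact one_ne_zero (aux_aniso hp h1).1

lemma aux_card_s9 {p : ℕ} [Fact p.Prime] (hp : p % 4 = 3) : p + 1 ≤ (circ p 1).card := by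
  have h2 := aux_two hp
  have hne : ∀ t : ZMod p, 1 + t ^ 2 ≠ 0 := by
    intro t h
    have h1 : (1 : ZMod p) ^ 2 + t ^ 2 = 0 := by linear_combination h
    exact one_ne_zero (aux_aniso hp h1).1
  let f : ZMod p → ZMod p × ZMod p := fun t => ((1 - t ^ 2) / (1 + t ^ 2), 2 * t / (1 + t ^ 2))
  have hx : ∀ t, 1 + (f t).1 = 2 / (1 + t ^ 2) := by
    intro t
    have := hne t
    simp only [f]
    field_simp
    ring
  have hy : ∀ t, (f t).2 = t * (1 + (f t).1) := by
    intro t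
    rw [hx]
    simp only [f]
    ring
  have hx0 : ∀ t, 1 + (f t).1 ≠ 0 := by
    intro t
    rw [hx]
    exact div_ne_zero h2 (hne t)
  have hinj : Function.Injective f := by
    intro s t h
    have h1 := hy s
    rw [h, hy t] at h1
    exact (mul_right_cancel₀ (hx0 t) h1).symm
  have hnot : ((-1 : ZMod p), (0 : ZMod p)) ∉ univ.image f := by
    simp only [mem_image, mem_univ, true_and, not_exists]
    intro t h
    apply hx0 t
    rw [h]
    ring
  have hc : (insert ((-1 : ZMod p), (0 : ZMod p)) (univ.image f)).card = p + 1 := by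
    rw [card_insert_of_notMem hnot, card_image_of_injective _ hinj, card_univ, ZMod.card]
  rw [← hc]
  apply card_le_card
  intro v hv
  simp only [mem_insert, mem_image, mem_univ, true_and] at hv
  simp only [circ, mem_filter, mem_univ, true_and]
  rcases hv with rfl | ⟨t, rfl⟩
  · ring
  · have := hne t
    simp only [f]
    field_simp
    ring

lemma aux_fiber {p : ℕ} [Fact p.Prime] (hp : p % 4 = 3) {b b' c c' : ZMod p × ZMod p}
    (hb : b ∈ circ p 1) (hb' : b' ∈ circ p 1) (hc : c ∈ circ p 1) (hc' : c' ∈ circ p 1)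
    (h : c + c' = b + b') (hz : b + b' ≠ 0) : c = b ∨ c = b' := by
  obtain ⟨b1, b2⟩ := b
  obtain ⟨d1, d2⟩ := b'
  obtain ⟨c1, c2⟩ := c
  obtain ⟨e1, e2⟩ := c'
  simp only [circ, mem_filter, mem_univ, true_and, Prod.mk_add_mk, Prod.mk.injEq, ne_eq,
    Prod.mk_eq_zero] at *
  obtain ⟨h1, h2⟩ := h
  obtain rfl : e1 = b1 + d1 - c1 := by linear_combination h1
  obtain rfl : e2 = b2 + d2 - c2 := by linear_combination h2
  have t2 := aux_two hp
  have A : (c1 - b1) * (b1 + d1) + (c2 - b2) * (b2 + d2) = 0 := by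
    apply mul_left_cancel₀ t2
    linear_combination hc - hc' - hb + hb'
  have B : (c1 - d1) * (b1 + d1) + (c2 - d2) * (b2 + d2) = 0 := by
    apply mul_left_cancel₀ t2
    linear_combination hc - hc' + hb - hb'
  have C : (c1 - d1) * (c1 - b1) + (c2 - d2) * (c2 - b2) = 0 := by
    linear_combination hc - hb - A
  by_cases hX : (c1 - b1) * (b2 + d2) - (c2 - b2) * (b1 + d1) = 0
  · left
    have hs : ((b1 + d1) ^ 2 + (b2 + d2) ^ 2) * ((c1 - b1) ^ 2 + (c2 - b2) ^ 2) = 0 := by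
      linear_combination ((c1 - b1) * (b1 + d1) + (c2 - b2) * (b2 + d2)) * A +
        ((c1 - b1) * (b2 + d2) - (c2 - b2) * (b1 + d1)) * hX
    rcases mul_eq_zero.1 hs with h0 | h0
    · exact absurd (aux_aniso hp h0) hz
    · have := aux_aniso hp h0
      exact ⟨sub_eq_zero.1 this.1, sub_eq_zero.1 this.2⟩
  · right
    constructor
    · apply sub_eq_zero.1
      apply (mul_eq_zero.1 _).resolve_right hX
      linear_combination (b2 + d2) * C - (c2 - b2) * B
    · apply sub_eq_zero.1
      apply (mul_eq_zero.1 _).resolve_right hX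
      linear_combination (c1 - b1) * B - (b1 + d1) * C

lemma aux_four {p : ℕ} [Fact p.Prime] (hp : p % 4 = 3) (v : ZMod p × ZMod p) :
    ∃ a ∈ circ p 1, ∃ b ∈ circ p 1, ∃ c ∈ circ p 1, ∃ d ∈ circ p 1, a + b + c + d = v := by
  classical
  set S := circ p 1 with hS
  let P := (S ×ˢ S).filter (fun x => x.1 + x.2 ≠ 0)
  let g : (ZMod p × ZMod p) × (ZMod p × ZMod p) → ZMod p × ZMod p := fun x => x.1 + x.2
  let T := insert 0 (P.image g)
  have hT : ∀ z ∈ T, ∃ a ∈ S, ∃ b ∈ S, a + b = z := by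
    intro z hz
    simp only [T, mem_insert, mem_image] at hz
    rcases hz with rfl | ⟨x, hx, rfl⟩
    · exact ⟨(1, 0), by simp [hS, circ], (-1, 0), by simp [hS, circ], by simp⟩
    · simp only [P, mem_filter, mem_product] at hx
      exact ⟨x.1, hx.1.1, x.2, hx.1.2, rfl⟩
  have h0 : (0 : ZMod p × ZMod p) ∉ P.image g := by
    simp only [mem_image, not_exists, not_and]
    intro x hx
    exact (mem_filter.1 hx).2
  have hTc : T.card = (P.image g).card + 1 := card_insert_of_notMem h0
  have hP2 : P.card ≤ 2 * (P.image g).card := by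
    apply card_le_mul_card_image
    intro z hz
    obtain ⟨x, hx, rfl⟩ := mem_image.1 hz
    refine le_trans (card_le_card (t := {(x.1, x.2), (x.2, x.1)}) ?_) card_le_two
    intro y hy
    simp only [P, g, mem_filter, mem_product] at hx hy
    obtain ⟨⟨⟨hy1, hy2⟩, -⟩, hyx⟩ := hy
    obtain ⟨⟨hx1, hx2⟩, hxz⟩ := hx
    simp only [mem_insert, mem_singleton]
    rcases aux_fiber hp hx1 hx2 hy1 hy2 hyx hxz with h | h
    · left
      rw [h] at hyx
      exact Prod.ext h (add_left_cancel hyx)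
    · right
      rw [h, add_comm] at hyx
      exact Prod.ext h (add_right_cancel hyx)
  have hZ : ((S ×ˢ S).filter (fun x => ¬ (x.1 + x.2 ≠ 0))).card ≤ S.card := by
    apply card_le_card_of_injOn Prod.fst
    · intro x hx
      simp only [coe_filter, Set.mem_setOf_eq, mem_product] at hx
      exact hx.1.1
    · intro x hx y hy hxy
      simp only [coe_filter, Set.mem_setOf_eq, mem_product, not_not] at hx hy
      refine Prod.ext hxy ?_
      have := hx.2.trans hy.2.symm
      rw [hxy] at this
      exact add_left_cancel this
  have hsum : P.card + ((S ×ˢ S).filter (fun x => ¬ (x.1 + x.2 ≠ 0))).card = S.card * S.card := by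
    rw [← card_product]
    exact card_filter_add_card_filter_not _
  have hSc : p + 1 ≤ S.card := aux_card_s9 hp
  have hbig : p * p < T.card + T.card := by nlinarith
  let U := T.image (fun z => v - z)
  have hU : U.card = T.card := card_image_of_injective _ sub_right_injective
  have hnd : ¬ Disjoint T U := by
    intro hd
    have h1 := card_union_of_disjoint hd
    have h2 := card_le_univ (T ∪ U)
    rw [Fintype.card_prod, ZMod.card] at h2
    omega
  obtain ⟨z, hz, hzU⟩ := not_disjoint_iff.1 hnd
  obtain ⟨w, hw, hwz⟩ := mem_image.1 hzU
  obtain ⟨a, ha, b, hb, hab⟩ := hT z hz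
  obtain ⟨c, hc, d, hd, hcd⟩ := hT w hw
  refine ⟨a, ha, b, hb, c, hc, d, hd, ?_⟩
  rw [add_assoc, hcd, hab, ← hwz]
  simp

lemma aux_nonneg (p : ℕ) [Fact p.Prime] (n : ℕ) (i j : ZMod p) : 0 ≤ (kerA p ^ n) i j := by
  induction n generalizing i with
  | zero =>
    rw [pow_zero, Matrix.one_apply]
    split_ifs <;> norm_num
  | succ m ih =>
    rw [pow_succ', Matrix.mul_apply]
    refine sum_nonneg fun k _ => mul_nonneg ?_ (ih k)
    unfold kerA
    positivity

lemma aux_step (p : ℕ) [Fact p.Prime] (m : ℕ) (a b : ZMod p × ZMod p) (j : ZMod p)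
    (hb : b ∈ circ p 1)
    (h : 0 < (kerA p ^ m) ((a + b).1 ^ 2 + (a + b).2 ^ 2) j) :
    0 < (kerA p ^ (m + 1)) (a.1 ^ 2 + a.2 ^ 2) j := by
  rw [pow_succ', Matrix.mul_apply]
  have ha : a ∈ circ p (a.1 ^ 2 + a.2 ^ 2) := by simp [circ]
  refine sum_pos' (fun k _ => mul_nonneg ?_ (aux_nonneg p m k j)) ⟨_, mem_univ _, mul_pos ?_ h⟩
  · unfold kerA
    positivity
  · unfold kerA
    refine div_pos ?_ (mul_pos ?_ ?_)
    · rw [Nat.cast_pos]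
      refine card_pos.2 ⟨(a, b), ?_⟩
      simp only [mem_filter, mem_product]
      exact ⟨⟨ha, hb⟩, by simp [circ]⟩
    · exact Nat.cast_pos.2 (card_pos.2 ⟨a, ha⟩)
    · exact Nat.cast_pos.2 (card_pos.2 ⟨b, hb⟩)

lemma aux_main (p : ℕ) [Fact p.Prime] (hp : p % 4 = 3) (m : ℕ) (a v : ZMod p × ZMod p) :
    0 < (kerA p ^ (m + 4)) (a.1 ^ 2 + a.2 ^ 2) (v.1 ^ 2 + v.2 ^ 2) := by
  induction m generalizing a with
  | zero =>
    obtain ⟨b, hb, c, hc, d, hd, e, he, h⟩ := aux_four hp (v - a)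
    refine aux_step p 3 a b _ hb (aux_step p 2 _ c _ hc (aux_step p 1 _ d _ hd
      (aux_step p 0 _ e _ he ?_)))
    have : a + b + c + d + e = v := by
      rw [← add_sub_cancel a v, ← h]
      abel
    rw [this, pow_zero, Matrix.one_apply_eq]
    norm_num
  | succ m ih =>
    have := aux_step p (m + 4) a (1, 0) (v.1 ^ 2 + v.2 ^ 2) (by simp [circ]) (ih _)
    rwa [show m + 1 + 4 = m + 4 + 1 by ring]

/-- for every `n ≥ 4` and all `i, j`, `(Aⁿ)(i,j) > 0`. -/
theorem kerA_pow_pos (p : ℕ) [Fact p.Prime] (hp : p % 4 = 3)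
    (n : ℕ) (hn : 4 ≤ n) (i j : ZMod p) :
    0 < (kerA p ^ n) i j := by
  obtain ⟨a, b, rfl⟩ := ZMod.sq_add_sq p i
  obtain ⟨c, d, rfl⟩ := ZMod.sq_add_sq p j
  obtain ⟨m, rfl⟩ := Nat.exists_eq_add_of_le' hn
  exact aux_main p hp m (a, b) (c, d)
end

section
/- Let p be a prime with p ≡ 3 (mod 4). For all i, j ∈ F_p, the (i,j) entry of the fourth matrix power A⁴ of the random-walk kernel A satisfies (A⁴)(i,j) ≥ (p²(p−1)/(p+1)⁴) · π(j). -/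
open Finset

section helpers

variable {p : ℕ} [Fact p.Prime]

/-- the quadrance -/
def qd (v : ZMod p × ZMod p) : ZMod p := v.1 ^ 2 + v.2 ^ 2

/-- complex multiplication -/
def cm (z v : ZMod p × ZMod p) : ZMod p × ZMod p :=
  (z.1 * v.1 - z.2 * v.2, z.1 * v.2 + z.2 * v.1)

lemma mem_circ (K : ZMod p) (v : ZMod p × ZMod p) : v ∈ circ p K ↔ qd v = K := by
  simp [circ, qd]

lemma qd_cm (z v : ZMod p × ZMod p) : qd (cm z v) = qd z * qd v := by
  simp only [qd, cm]; ring

lemma cm_add (z v w : ZMod p × ZMod p) : cm z (v + w) = cm z v + cm z w := by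
  ext <;> simp [cm] <;> ring

lemma qd_eq_zero (hp : p % 4 = 3) (v : ZMod p × ZMod p) (h : qd v = 0) : v = 0 := by
  have hns : ¬ IsSquare (-1 : ZMod p) := by
    rw [ZMod.exists_sq_eq_neg_one_iff]; omega
  simp only [qd] at h
  by_cases h2 : v.2 = 0
  · rw [h2] at h
    have h1 : v.1 = 0 := by simpa using h
    ext <;> simp [h1, h2]
  · exfalso
    apply hns
    refine ⟨v.1 / v.2, ?_⟩
    field_simp
    linear_combination -h

lemma cm_inj (hp : p % 4 = 3) (z : ZMod p × ZMod p) (hz : qd z ≠ 0) :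
    Function.Injective (cm z) := by
  intro v w h
  have h1 : cm z (v - w) = 0 := by
    have := cm_add z (v - w) w
    rw [sub_add_cancel, h] at this
    simpa using this
  have h2 : qd z * qd (v - w) = 0 := by
    rw [← qd_cm, h1]; simp [qd]
  exact sub_eq_zero.mp (qd_eq_zero hp _ ((mul_eq_zero.mp h2).resolve_left hz))

lemma exists_qd (k : ZMod p) : ∃ v : ZMod p × ZMod p, qd v = k := by
  obtain ⟨a, b, h⟩ := ZMod.sq_add_sq p k
  exact ⟨(a, b), h⟩

lemma card_circ_le (hp : p % 4 = 3) (i j : ZMod p) (hi : i ≠ 0) (hj : j ≠ 0) :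
    (circ p i).card ≤ (circ p j).card := by
  obtain ⟨z, hz⟩ := exists_qd (j / i)
  have hz0 : qd z ≠ 0 := by rw [hz]; exact div_ne_zero hj hi
  refine Finset.card_le_card_of_injOn (cm z) ?_ ((cm_inj hp z hz0).injOn)
  intro v hv
  have hv' := (mem_circ _ _).mp (Finset.mem_coe.mp hv)
  refine Finset.mem_coe.mpr ((mem_circ _ _).mpr ?_)
  rw [qd_cm, hz, hv']
  field_simp

lemma card_circ_zero (hp : p % 4 = 3) : (circ p 0).card = 1 := by
  rw [Finset.card_eq_one]
  refine ⟨0, ?_⟩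
  ext v
  rw [mem_circ, Finset.mem_singleton]
  constructor
  · exact qd_eq_zero hp v
  · rintro rfl; simp [qd]

lemma card_circ (hp : p % 4 = 3) (j : ZMod p) (hj : j ≠ 0) : (circ p j).card = p + 1 := by
  have h1 : (Finset.univ : Finset (ZMod p × ZMod p)).card
      = ∑ k : ZMod p, (circ p k).card := by
    rw [Finset.card_eq_sum_card_fiberwise (f := qd) (t := Finset.univ) (by intro x _; simp)]
    rfl
  rw [← Finset.add_sum_erase _ _ (Finset.mem_univ (0 : ZMod p)), card_circ_zero hp,
    Finset.sum_congr rfl (g := fun _ => (circ p j).card)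
      (fun k hk => le_antisymm (card_circ_le hp k j (Finset.ne_of_mem_erase hk) hj)
        (card_circ_le hp j k hj (Finset.ne_of_mem_erase hk)))] at h1
  simp only [Finset.card_univ, Fintype.card_prod, ZMod.card, Finset.sum_const,
    Finset.card_erase_of_mem (Finset.mem_univ (0 : ZMod p)), smul_eq_mul] at h1
  obtain ⟨r, rfl⟩ : ∃ r, p = r + 2 := ⟨p - 2, by omega⟩
  have : r + 2 - 1 = r + 1 := rfl
  rw [this] at h1
  have h2 : (r + 1) * (circ (r+2) j).card = (r + 1) * (r + 2 + 1) := by nlinarith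
  exact Nat.eq_of_mul_eq_mul_left (by omega) h2

/-- one step count -/
def cnt (v : ZMod p × ZMod p) (j : ZMod p) : ℕ :=
  ((circ p 1).filter (fun u => qd (v + u) = j)).card

lemma cnt_le (hp : p % 4 = 3) (v w : ZMod p × ZMod p) (h : qd v = qd w) (j : ZMod p) :
    cnt v j ≤ cnt w j := by
  by_cases h0 : qd v = 0
  · rw [qd_eq_zero hp v h0, qd_eq_zero hp w (h ▸ h0)]
  · obtain ⟨z, hz, hzv⟩ : ∃ z : ZMod p × ZMod p, qd z = 1 ∧ cm z v = w := by
      have hv : v.1 ^ 2 + v.2 ^ 2 ≠ 0 := h0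
      have hw : v.1 ^ 2 + v.2 ^ 2 = w.1 ^ 2 + w.2 ^ 2 := h
      refine ⟨((w.1 * v.1 + w.2 * v.2) / (v.1 ^ 2 + v.2 ^ 2),
        (w.2 * v.1 - w.1 * v.2) / (v.1 ^ 2 + v.2 ^ 2)), ?_, ?_⟩
      · simp only [qd]
        field_simp
        linear_combination (-(v.1 ^ 2 + v.2 ^ 2)) * hw
      · ext
        · simp only [cm]
          field_simp
          ring
        · simp only [cm]
          field_simp
          ring
    unfold cnt
    refine Finset.card_le_card_of_injOn (cm z) ?_ ((cm_inj hp z (by simp [hz])).injOn)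
    intro u hu
    have hu' := Finset.mem_filter.mp (Finset.mem_coe.mp hu)
    refine Finset.mem_coe.mpr (Finset.mem_filter.mpr ⟨(mem_circ _ _).mpr ?_, ?_⟩)
    · rw [qd_cm, hz, (mem_circ _ _).mp hu'.1, one_mul]
    · rw [← hzv, ← cm_add, qd_cm, hz, hu'.2, one_mul]

lemma kerA_eq (hp : p % 4 = 3) (v : ZMod p × ZMod p) (j : ZMod p) :
    kerA p (qd v) j = (cnt v j : ℝ) / ((p : ℝ) + 1) := by
  have h1 : Ncirc p (qd v) 1 j = (circ p (qd v)).card * cnt v j := by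
    unfold Ncirc
    rw [Finset.card_filter, Finset.sum_product, ← smul_eq_mul, ← Finset.sum_const]
    refine Finset.sum_congr rfl fun a ha => ?_
    rw [← Finset.card_filter]
    have : cnt a j = cnt v j := le_antisymm (cnt_le hp _ _ ((mem_circ _ _).mp ha) j)
      (cnt_le hp _ _ ((mem_circ _ _).mp ha).symm j)
    rw [← this]
    unfold cnt
    congr 1
    refine Finset.filter_congr fun u _ => ?_
    exact mem_circ _ _
  have hpos : (0 : ℝ) < (circ p (qd v)).card := by
    have : 0 < (circ p (qd v)).card := Finset.card_pos.mpr ⟨v, (mem_circ _ _).mpr rfl⟩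
    exact_mod_cast this
  unfold kerA
  rw [h1, card_circ hp 1 one_ne_zero]
  push_cast
  field_simp

lemma step (hp : p % 4 = 3) (v : ZMod p × ZMod p) (g : ZMod p → ℝ) :
    ∑ k, kerA p (qd v) k * g k = (∑ u ∈ circ p 1, g (qd (v + u))) / ((p : ℝ) + 1) := by
  rw [Finset.sum_div]
  have : ∀ k, kerA p (qd v) k * g k
      = ∑ u ∈ circ p 1, if qd (v + u) = k then g k / ((p : ℝ) + 1) else 0 := by
    intro k
    rw [kerA_eq hp, ← Finset.sum_filter, Finset.sum_const, nsmul_eq_mul]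
    unfold cnt
    ring
  rw [Finset.sum_congr rfl fun k _ => this k, Finset.sum_comm]
  refine Finset.sum_congr rfl fun u _ => ?_
  simp

lemma pow_succ_apply (hp : p % 4 = 3) (n : ℕ) (v : ZMod p × ZMod p) (j : ZMod p) :
    (kerA p ^ (n + 1)) (qd v) j
      = (∑ u ∈ circ p 1, (kerA p ^ n) (qd (v + u)) j) / ((p : ℝ) + 1) := by
  rw [pow_succ', Matrix.mul_apply]
  exact step hp v (fun k => (kerA p ^ n) k j)

/-- sums of two unit vectors -/
def SS (p : ℕ) [Fact p.Prime] : Finset (ZMod p × ZMod p) :=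
  (circ p 1 ×ˢ circ p 1).image (fun ab => ab.1 + ab.2)

lemma pair_unique (hp : p % 4 = 3) (x u t : ZMod p × ZMod p) (hx : x ≠ 0)
    (hu : qd u = 1) (hu' : qd (x - u) = 1) (ht : qd t = 1) (ht' : qd (x - t) = 1) :
    u = t ∨ u = x - t := by
  have two : (2 : ZMod p) ≠ 0 := by
    intro h
    have h' : ((2 : ℕ) : ZMod p) = 0 := by exact_mod_cast h
    rw [ZMod.natCast_eq_zero_iff] at h'
    have := Nat.le_of_dvd (by norm_num) h'
    interval_cases p <;> omega
  have hqx : qd x ≠ 0 := fun h => hx (qd_eq_zero hp x h)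
  obtain ⟨x1, x2⟩ := x
  obtain ⟨u1, u2⟩ := u
  obtain ⟨t1, t2⟩ := t
  simp only [qd, Prod.mk_sub_mk] at *
  have hD : (u1 - t1) * x1 + (u2 - t2) * x2 = 0 := by
    apply mul_left_cancel₀ two
    linear_combination hu - hu' - ht + ht'
  have hE : (u1 + t1 - x1) * x1 + (u2 + t2 - x2) * x2 = 0 := by
    apply mul_left_cancel₀ two
    linear_combination hu - hu' + ht - ht'
  have hDE : (u1 - t1) * (u1 + t1 - x1) + (u2 - t2) * (u2 + t2 - x2) = 0 := by
    linear_combination hu - ht - hD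
  have hc : ((u1 - t1) * x2 - (u2 - t2) * x1) * ((u1 + t1 - x1) * x2 - (u2 + t2 - x2) * x1) = 0 := by
    linear_combination (x1 ^ 2 + x2 ^ 2) * hDE
      - ((u1 + t1 - x1) * x1 + (u2 + t2 - x2) * x2) * hD
  rcases mul_eq_zero.mp hc with h | h
  · left
    ext
    · apply sub_eq_zero.mp
      apply mul_left_cancel₀ hqx
      linear_combination x1 * hD + x2 * h
    · apply sub_eq_zero.mp
      apply mul_left_cancel₀ hqx
      linear_combination x2 * hD - x1 * h
  · right
    ext
    · apply sub_eq_zero.mp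
      apply mul_left_cancel₀ hqx
      simp only
      linear_combination x1 * hE + x2 * h
    · apply sub_eq_zero.mp
      apply mul_left_cancel₀ hqx
      simp only
      linear_combination x2 * hE - x1 * h

lemma card_SS (hp : p % 4 = 3) : p ^ 2 + p + 2 ≤ 2 * (SS p).card := by
  have h1 := Finset.card_eq_sum_card_image (fun ab : (ZMod p × ZMod p) × (ZMod p × ZMod p) =>
    ab.1 + ab.2) (circ p 1 ×ˢ circ p 1)
  rw [Finset.card_product, card_circ hp 1 one_ne_zero] at h1
  change _ = ∑ x ∈ SS p, _ at h1
  have h0 : (0 : ZMod p × ZMod p) ∈ SS p := by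
    refine Finset.mem_image.mpr ⟨((1, 0), (-1, 0)), ?_, by simp⟩
    rw [Finset.mem_product, mem_circ, mem_circ]
    simp [qd]
  rw [← Finset.add_sum_erase _ _ h0] at h1
  have hz : ((circ p 1 ×ˢ circ p 1).filter (fun ab => ab.1 + ab.2 = 0)).card ≤ p + 1 := by
    rw [← card_circ hp 1 one_ne_zero]
    refine Finset.card_le_card_of_injOn Prod.fst ?_ ?_
    · intro ab h
      exact (Finset.mem_product.mp (Finset.mem_filter.mp (Finset.mem_coe.mp h)).1).1
    · intro a ha b hb hab
      have ha' := (Finset.mem_filter.mp (Finset.mem_coe.mp ha)).2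
      have hb' := (Finset.mem_filter.mp (Finset.mem_coe.mp hb)).2
      refine Prod.ext hab ?_
      rw [eq_neg_of_add_eq_zero_right ha', eq_neg_of_add_eq_zero_right hb', hab]
  have hs : ∑ x ∈ (SS p).erase 0,
      ((circ p 1 ×ˢ circ p 1).filter (fun ab => ab.1 + ab.2 = x)).card
      ≤ ((SS p).erase 0).card * 2 := by
    refine Finset.sum_le_card_nsmul _ _ _ fun x hx => ?_
    obtain ⟨hx0, hxS⟩ := Finset.mem_erase.mp hx
    obtain ⟨⟨t, t'⟩, ht, htx⟩ := Finset.mem_image.mp hxS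
    rw [Finset.mem_product, mem_circ, mem_circ] at ht
    simp only at ht htx
    have ht' : t' = x - t := by rw [← htx]; abel
    refine le_trans (Finset.card_le_card (t := {(t, x - t), (x - t, t)}) ?_) Finset.card_le_two
    rintro ⟨u, u'⟩ hu
    rw [Finset.mem_filter, Finset.mem_product, mem_circ, mem_circ] at hu
    simp only at hu
    have hu' : u' = x - u := by rw [← hu.2]; abel
    have := pair_unique hp x u t hx0 hu.1.1 (hu' ▸ hu.1.2) ht.1 (ht' ▸ ht.2)
    rw [Finset.mem_insert, Finset.mem_singleton, hu']
    rcases this with h | h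
    · left; rw [h]
    · right; rw [h]; simp
  rw [Finset.card_erase_of_mem h0] at hs
  have hpos : 0 < (SS p).card := Finset.card_pos.mpr ⟨0, h0⟩
  obtain ⟨m, hm⟩ : ∃ m, (SS p).card = m + 1 := ⟨_, (Nat.succ_pred_eq_of_pos hpos).symm⟩
  rw [hm] at hs ⊢
  simp only [Nat.add_sub_cancel] at hs
  nlinarith

lemma card_inter (hp : p % 4 = 3) (w : ZMod p × ZMod p) :
    p + 2 ≤ ((SS p).filter (fun x => w - x ∈ SS p)).card := by
  have h1 : (SS p).filter (fun x => w - x ∈ SS p) = SS p ∩ (SS p).image (fun x => w - x) := by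
    ext x
    simp only [Finset.mem_filter, Finset.mem_inter, Finset.mem_image]
    refine and_congr_right fun _ => ⟨fun h => ⟨_, h, by simp⟩, ?_⟩
    rintro ⟨y, hy, rfl⟩
    simpa using hy
  have h2 : ((SS p).image (fun x => w - x)).card = (SS p).card :=
    Finset.card_image_of_injective _ (sub_right_injective)
  have h3 := Finset.card_union_add_card_inter (SS p) ((SS p).image (fun x => w - x))
  have h4 := Finset.card_le_univ (SS p ∪ (SS p).image (fun x => w - x))
  rw [Fintype.card_prod, ZMod.card] at h4
  have h5 := card_SS hp
  rw [h1]
  nlinarith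

lemma sum_SS_le (h : ZMod p × ZMod p → ℝ) (hh : ∀ x, 0 ≤ h x) :
    ∑ x ∈ SS p, h x ≤ ∑ u ∈ circ p 1, ∑ t ∈ circ p 1, h (u + t) := by
  rw [← Finset.sum_product' (f := fun u t => h (u + t))]
  rw [Finset.sum_comp h (fun ab : (ZMod p × ZMod p) × (ZMod p × ZMod p) => ab.1 + ab.2)]
  change _ ≤ ∑ x ∈ SS p, _
  refine Finset.sum_le_sum fun x hx => ?_
  rw [nsmul_eq_mul]
  refine le_mul_of_one_le_left (hh x) ?_
  obtain ⟨ab, h1, h2⟩ := Finset.mem_image.mp hx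
  have : 0 < ((circ p 1 ×ˢ circ p 1).filter (fun ab => ab.1 + ab.2 = x)).card :=
    Finset.card_pos.mpr ⟨ab, Finset.mem_filter.mpr ⟨h1, h2⟩⟩
  exact_mod_cast this

lemma double_sum (hp : p % 4 = 3) (v : ZMod p × ZMod p) (j : ZMod p) :
    ((circ p j).card : ℝ) * ((p : ℝ) + 2)
      ≤ ∑ x ∈ SS p, ∑ y ∈ SS p, if qd (v + x + y) = j then (1 : ℝ) else 0 := by
  have h1 : ∀ x ∈ SS p, (∑ y ∈ SS p, if qd (v + x + y) = j then (1 : ℝ) else 0)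
      = ∑ w ∈ circ p j, if w - v - x ∈ SS p then (1 : ℝ) else 0 := by
    intro x _
    rw [← Finset.sum_filter, ← Finset.sum_filter]
    refine Finset.sum_bij' (fun y _ => v + x + y) (fun w _ => w - v - x) ?_ ?_ ?_ ?_ ?_
    · intro y hy
      rw [Finset.mem_filter] at hy ⊢
      refine ⟨(mem_circ _ _).mpr hy.2, ?_⟩
      have : v + x + y - v - x = y := by abel
      rw [this]; exact hy.1
    · intro w hw
      rw [Finset.mem_filter] at hw ⊢
      refine ⟨hw.2, ?_⟩
      have : v + x + (w - v - x) = w := by abel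
      rw [this]; exact (mem_circ _ _).mp hw.1
    · intro y _; abel
    · intro w _; abel
    · intro _ _; rfl
  rw [Finset.sum_congr rfl h1, Finset.sum_comm, ← nsmul_eq_mul]
  refine Finset.card_nsmul_le_sum _ _ _ fun w _ => ?_
  rw [← Finset.sum_filter, Finset.sum_const, nsmul_eq_mul, mul_one]
  exact_mod_cast card_inter hp (w - v)

lemma pow_four_ge (hp : p % 4 = 3) (v : ZMod p × ZMod p) (j : ZMod p) :
    ((circ p j).card : ℝ) * ((p : ℝ) + 2) / ((p : ℝ) + 1) ^ 4 ≤ (kerA p ^ 4) (qd v) j := by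
  have h : (kerA p ^ 4) (qd v) j = (∑ a ∈ circ p 1, ∑ b ∈ circ p 1, ∑ c ∈ circ p 1,
      ∑ d ∈ circ p 1, if qd (v + (a + b) + (c + d)) = j then (1 : ℝ) else 0)
      / ((p : ℝ) + 1) ^ 4 := by
    simp only [pow_succ_apply hp 3, pow_succ_apply hp 2, pow_succ_apply hp 1,
      pow_succ_apply hp 0, pow_zero, Matrix.one_apply, ← Finset.sum_div, add_assoc]
    field_simp
  rw [h]
  have hpos : (0 : ℝ) ≤ ((p : ℝ) + 1) ^ 4 := by positivity
  refine div_le_div_of_nonneg_right (le_trans (double_sum hp v j) ?_) hpos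
  refine le_trans (Finset.sum_le_sum fun x _ =>
    sum_SS_le (fun y => if qd (v + x + y) = j then (1 : ℝ) else 0) ?_) ?_
  · intro y; positivity
  · refine sum_SS_le (fun x => ∑ c ∈ circ p 1, ∑ d ∈ circ p 1,
      if qd (v + x + (c + d)) = j then (1 : ℝ) else 0) ?_
    intro x; positivity

end helpers

/-- `(A⁴)(i,j) ≥ (p²(p−1)/(p+1)⁴) · π(j)` for all `i, j`. -/
theorem kerA_pow_four_lower_bound (p : ℕ) [Fact p.Prime] (hp : p % 4 = 3) (i j : ZMod p) :
    (kerA p ^ 4) i j ≥ (p : ℝ) ^ 2 * ((p : ℝ) - 1) / ((p : ℝ) + 1) ^ 4 * piDist p j := by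
  obtain ⟨v, rfl⟩ := exists_qd i
  refine le_trans ?_ (pow_four_ge hp v j)
  have hp0 : (0 : ℝ) < p := by exact_mod_cast (Fact.out : p.Prime).pos
  have hc : piDist p j = ((circ p j).card : ℝ) / (p : ℝ) ^ 2 := by
    unfold piDist
    split_ifs with h
    · rw [h, card_circ_zero hp]; norm_num
    · rw [card_circ hp j h]; push_cast; rfl
  rw [hc]
  have h2 : (p : ℝ) ^ 2 * ((p : ℝ) - 1) / ((p : ℝ) + 1) ^ 4 * (((circ p j).card : ℝ) / (p : ℝ) ^ 2)
      = ((circ p j).card : ℝ) * ((p : ℝ) - 1) / ((p : ℝ) + 1) ^ 4 := by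
    field_simp
  rw [h2]
  gcongr
  linarith
end
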